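/- Let λ be a partition with l(λ) = s and let m ≥ s. Then there exists a finitely supported family of natural numbers c_ν, indexed by partitions ν ≠ λ with l(ν) ≤ m, such that in ℤ[X_1,…,X_m] one has h_{λ_1} · h_{λ_2} ⋯ h_{λ_s} = S_λ^{(m)} + Σ_{ν ≠ λ} c_ν S_ν^{(m)}; in particular S_λ^{(m)} occurs in the product h_{λ_1}⋯h_{λ_s} with coefficient exactly one. -/

import Mathlib

open MvPolynomial

/-- A partition: a weakly decreasing sequence of nonnegative integers with
finitely many nonzero terms. `parts i` is the `(i+1)`-st part `λ_{i+1}`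
(0-indexed). -/
structure Partition' where
  parts : ℕ → ℕ
  antitone : Antitone parts
  eventually_zero : ∃ N, parts N = 0

namespace Partition'

/-- The length `l(λ)`: the number of nonzero parts, i.e. the least index
at which the (weakly decreasing) sequence of parts vanishes. -/
noncomputable def length (lam : Partition') : ℕ := sInf {n | lam.parts n = 0}

/-- The size `|λ| = Σᵢ λᵢ`. -/
noncomputable def size (lam : Partition') : ℕ := ∑ᶠ i, lam.parts i

/-- The partition `(μ_1, …, μ_{r-1})` obtained from `μ` by deleting all parts
from the `r`-th one on. -/
def drop (mu : Partition') (r : ℕ) : Partition' where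
  parts i := if i + 1 < r then mu.parts i else 0
  antitone := by
    intro i j hij
    dsimp only
    split_ifs with h1 h2
    · exact mu.antitone hij
    · omega
    · exact Nat.zero_le _
    · exact le_refl 0
  eventually_zero := ⟨r, if_neg (by omega)⟩

end Partition'

/-- `IsHorizontalStrip mu xi` says that the skew shape `μ/ξ` is a horizontal
strip: `μ_i ≥ ξ_i ≥ μ_{i+1}` for all `i ≥ 1`. -/
def IsHorizontalStrip (mu xi : Partition') : Prop :=
  ∀ i, xi.parts i ≤ mu.parts i ∧ mu.parts (i + 1) ≤ xi.parts i

/-- The size `|μ/ξ| = |μ| - |ξ|` of a skew shape, computed as the sum of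
the pointwise differences of the parts. -/
noncomputable def stripSize (mu xi : Partition') : ℕ := ∑ᶠ i, (mu.parts i - xi.parts i)

/-- The complete homogeneous symmetric polynomial `h_d` in `m` variables over `ℤ`,
extended by `h_d = 0` for `d < 0` (and `h_0 = 1`). -/
noncomputable def hpoly (m : ℕ) (d : ℤ) : MvPolynomial (Fin m) ℤ :=
  if 0 ≤ d then MvPolynomial.hsymm (Fin m) ℤ d.toNat else 0

/-- The Schur polynomial `S_λ^{(m)} ∈ ℤ[X_1,…,X_m]`, defined by the Jacobi–Trudi
formula `S_λ^{(m)} = det (h_{λ_i - i + j})_{1 ≤ i,j ≤ N}` with `N = l(λ)`. -/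
noncomputable def schur (m : ℕ) (lam : Partition') : MvPolynomial (Fin m) ℤ :=
  Matrix.det (Matrix.of fun i j : Fin lam.length =>
    hpoly m ((lam.parts i : ℤ) - (i : ℤ) + (j : ℤ)))

/-- The ring homomorphism `p_n : ℤ[X_1,…,X_{n+1}] → ℤ[X_1,…,X_n]` determined by
`X_i ↦ X_i` for `i ≤ n` and `X_{n+1} ↦ 0`. -/
noncomputable def pmap (n : ℕ) : MvPolynomial (Fin (n + 1)) ℤ →ₐ[ℤ] MvPolynomial (Fin n) ℤ :=
  aeval (fun i : Fin (n + 1) => if h : (i : ℕ) < n then X (⟨i, h⟩ : Fin n) else 0)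

section JTAux

variable {R : Type*} [CommRing R]

/-- The determinant `det (h_{a_i + j})`. -/
noncomputable def jtDet (h : ℤ → R) {n : ℕ} (a : Fin n → ℤ) : R :=
  Matrix.det (Matrix.of fun i j : Fin n => h (a i + (j : ℕ)))

lemma det_last_row {S : Type*} [CommRing S] {n : ℕ} (A : Matrix (Fin (n + 1)) (Fin (n + 1)) S)
    (h0 : ∀ j : Fin n, A (Fin.last n) j.castSucc = 0) :
    A.det = A (Fin.last n) (Fin.last n) *
      Matrix.det (Matrix.of fun i j : Fin n => A i.castSucc j.castSucc) := by
  rw [Matrix.det_succ_row A (Fin.last n), Fin.sum_univ_castSucc]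
  simp only [h0, mul_zero, zero_mul, Finset.sum_const_zero, zero_add, Fin.succAbove_last]
  have : ((-1 : S) ^ (((Fin.last n : Fin (n+1)) : ℕ) + ((Fin.last n : Fin (n+1)) : ℕ))) = 1 :=
    Even.neg_one_pow ⟨_, rfl⟩
  rw [this, one_mul]
  rfl

lemma jtDet_snoc (h : ℤ → R) (hneg : ∀ d < 0, h d = 0) (h0 : h 0 = 1) {n : ℕ}
    (a : Fin (n + 1) → ℤ) (ha : a (Fin.last n) = -(n : ℤ)) :
    jtDet h a = jtDet h (fun i : Fin n => a i.castSucc) := by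
  unfold jtDet
  rw [det_last_row]
  · simp [ha, h0]
  · intro j
    simp only [Matrix.of_apply, ha]
    apply hneg
    have := j.isLt
    simp only [Fin.val_castSucc]
    omega

lemma det_col_back {S : Type*} [CommRing S] {n : ℕ} (A B : Matrix (Fin (n + 1)) (Fin (n + 1)) S)
    (c : S) (hl : ∀ i, A i (Fin.last n) = B i (Fin.last n))
    (hc : ∀ i (j : Fin n), A i j.castSucc = B i j.castSucc + c * A i j.succ) :
    A.det = B.det := by
  rw [← Matrix.det_submatrix_equiv_self Fin.revPerm A, ← Matrix.det_submatrix_equiv_self Fin.revPerm B]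
  apply Matrix.det_eq_of_forall_col_eq_smul_add_pred (fun _ => c)
  · intro i
    simp [hl]
  · intro i j
    simp only [Matrix.submatrix_apply, Fin.revPerm_apply, Fin.rev_succ, Fin.rev_castSucc]
    exact hc _ _

lemma jtDet_mul (h : ℤ → R) (hneg : ∀ d < 0, h d = 0) {n : ℕ}
    (a : Fin (n + 1) → ℤ) (ha : a (Fin.last n) = -(n : ℤ)) (k : ℕ) :
    h k * jtDet h (fun i : Fin n => a i.castSucc) =
      ∑ β ∈ Finset.finsuppAntidiag (Finset.univ : Finset (Fin (n + 1))) k,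
        jtDet h (fun i => a i + (β i : ℕ)) := by
  classical
  let G : ℤ → PowerSeries R := fun z => PowerSeries.mk fun b => h (z + b)
  have hG : ∀ z, G z = PowerSeries.C (h z) + PowerSeries.X * G (z + 1) := by
    intro z
    ext b
    cases b with
    | zero => simp [G]
    | succ b =>
      simp only [G, map_add, PowerSeries.coeff_succ_X_mul, PowerSeries.coeff_mk,
        PowerSeries.coeff_C]
      simp
      congr 1
      ring
  let M : Matrix (Fin (n + 1)) (Fin (n + 1)) (PowerSeries R) :=
    Matrix.of fun i j => G (a i + (j : ℕ))
  let B : Matrix (Fin (n + 1)) (Fin (n + 1)) (PowerSeries R) :=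
    Matrix.of fun i j => if j = Fin.last n then G (a i + n) else PowerSeries.C (h (a i + (j : ℕ)))
  have h1 : M.det = B.det := by
    apply det_col_back M B PowerSeries.X
    · intro i; simp [M, B]
    · intro i j
      have hj : j.castSucc ≠ Fin.last n := Fin.castSucc_ne_last j
      simp only [M, B, Matrix.of_apply, if_neg hj]
      rw [hG]
      simp only [Fin.val_castSucc, Fin.val_succ]
      congr 3
      push_cast
      ring
  have h2 : B.det = G 0 * PowerSeries.C (jtDet h (fun i : Fin n => a i.castSucc)) := by
    rw [det_last_row]
    · congr 1
      · simp [B, ha]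
      · unfold jtDet
        rw [RingHom.map_det]
        congr 1
        ext1 i j
        simp [B]
    · intro j
      have hj : j.castSucc ≠ Fin.last n := Fin.castSucc_ne_last j
      simp only [B, Matrix.of_apply, if_neg hj, ha]
      rw [hneg, map_zero]
      have := j.isLt
      simp only [Fin.val_castSucc]
      omega
  have h3 : PowerSeries.coeff k M.det = h k * jtDet h (fun i : Fin n => a i.castSucc) := by
    rw [h1, h2, PowerSeries.coeff_mul_C]
    simp [G]
  rw [← h3, ← Matrix.det_transpose, Matrix.det_apply, map_sum]
  simp only [jtDet]
  have h4 : ∀ β : Fin (n + 1) →₀ ℕ,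
      Matrix.det (Matrix.of fun i j : Fin (n + 1) => h (a i + (β i : ℕ) + (j : ℕ))) =
      ∑ σ : Equiv.Perm (Fin (n + 1)), Equiv.Perm.sign σ •
        ∏ i, h (a i + (β i : ℕ) + (σ i : ℕ)) := by
    intro β
    rw [← Matrix.det_transpose, Matrix.det_apply]
    rfl
  simp only [h4]
  rw [Finset.sum_comm]
  refine Finset.sum_congr rfl fun σ _ => ?_
  rw [← Finset.smul_sum, Units.smul_def, Units.smul_def, map_zsmul, PowerSeries.coeff_prod]
  congr 1
  refine Finset.sum_congr rfl fun β _ => Finset.prod_congr rfl fun i _ => ?_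
  simp only [M, G, Matrix.transpose_apply, Matrix.of_apply, PowerSeries.coeff_mk]
  congr 1
  ring

lemma jtDet_cancel (h : ℤ → R) {n : ℕ} (a : Fin (n + 1) → ℤ)
    (ha : ∀ i : Fin n, a i.succ < a i.castSucc) (k : ℕ) :
    ∑ β ∈ (Finset.finsuppAntidiag (Finset.univ : Finset (Fin (n + 1))) k).filter
        (fun β => ¬ ∀ i : Fin n, a i.succ + (β i.succ : ℕ) < a i.castSucc),
        jtDet h (fun i => a i + (β i : ℕ)) = 0 := by
  classical
  have hmax : ∀ β : Fin (n + 1) →₀ ℕ, (¬ ∀ i : Fin n, a i.succ + (β i.succ : ℕ) < a i.castSucc) →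
      ∃ i : Fin n, a i.castSucc ≤ a i.succ + (β i.succ : ℕ) ∧
        ∀ j, i < j → a j.succ + (β j.succ : ℕ) < a j.castSucc := by
    intro β hβ
    push Not at hβ
    obtain ⟨i, hi, hm⟩ := (Set.toFinite {i : Fin n | a i.castSucc ≤ a i.succ + (β i.succ : ℕ)}).exists_maximal hβ
    refine ⟨i, hi, fun j hj => ?_⟩
    by_contra hc
    push Not at hc
    exact absurd (hm hc hj.le) (not_le.mpr hj)
  choose idx hidx using hmax
  let g : (i : Fin n) → (Fin (n + 1) →₀ ℕ) → (Fin (n + 1) →₀ ℕ) := fun i β =>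
    Finsupp.equivFunOnFinite.symm fun j =>
      (a (Equiv.swap i.castSucc i.succ j) + (β (Equiv.swap i.castSucc i.succ j) : ℕ) - a j).toNat
  have hg : ∀ (i : Fin n) (β : Fin (n + 1) →₀ ℕ), a i.castSucc ≤ a i.succ + (β i.succ : ℕ) →
      ∀ j, a j + ((g i β j : ℕ) : ℤ) = a (Equiv.swap i.castSucc i.succ j) +
        (β (Equiv.swap i.castSucc i.succ j) : ℕ) := by
    intro i β hb j
    have hai := ha i
    simp only [g, Finsupp.equivFunOnFinite_symm_apply_apply]
    rw [Int.toNat_of_nonneg]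
    · ring
    · by_cases h1 : j = i.castSucc
      · subst h1; rw [Equiv.swap_apply_left]; omega
      · by_cases h2 : j = i.succ
        · subst h2; rw [Equiv.swap_apply_right]; omega
        · rw [Equiv.swap_apply_of_ne_of_ne h1 h2]; omega
  -- the swapped sequence has the same maximal bad index
  have hg_bad : ∀ (i : Fin n) (β : Fin (n + 1) →₀ ℕ), a i.castSucc ≤ a i.succ + (β i.succ : ℕ) →
      a i.castSucc ≤ a i.succ + (g i β i.succ : ℕ) := by
    intro i β hb
    rw [hg i β hb, Equiv.swap_apply_right]
    omega
  have hg_good : ∀ (i : Fin n) (β : Fin (n + 1) →₀ ℕ), a i.castSucc ≤ a i.succ + (β i.succ : ℕ) →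
      (∀ j, i < j → a j.succ + (β j.succ : ℕ) < a j.castSucc) →
      ∀ j, i < j → a j.succ + (g i β j.succ : ℕ) < a j.castSucc := by
    intro i β hb hj j hij
    have := hj j hij
    rw [hg i β hb, Equiv.swap_apply_of_ne_of_ne]
    · exact this
    · intro h; rw [Fin.ext_iff] at h; simp at h; omega
    · intro h; rw [Fin.ext_iff] at h; simp at h; omega
  have hperm : ∀ (i : Fin n) (β : Fin (n + 1) →₀ ℕ), a i.castSucc ≤ a i.succ + (β i.succ : ℕ) →
      jtDet h (fun j => a j + (g i β j : ℕ)) = - jtDet h (fun j => a j + (β j : ℕ)) := by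
    intro i β hb
    have := Matrix.det_permute (Equiv.swap i.castSucc i.succ)
      (Matrix.of fun r c : Fin (n + 1) => h (a r + (β r : ℕ) + (c : ℕ)))
    rw [Equiv.Perm.sign_swap (Fin.castSucc_lt_succ).ne] at this
    unfold jtDet
    simp only [hg i β hb]
    refine Eq.trans ?_ (this.trans (by simp))
    rfl
  refine Finset.sum_involution (fun β hβ => g (idx β (Finset.mem_filter.mp hβ).2) β) ?_ ?_ ?_ ?_
  · intro β hβ
    rw [hperm _ _ (hidx β _).1]
    ring
  · intro β hβ hne heq
    apply hne
    obtain ⟨hb, -⟩ := hidx β (Finset.mem_filter.mp hβ).2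
    set i := idx β (Finset.mem_filter.mp hβ).2
    have h1 := hg i β hb i.succ
    rw [heq, Equiv.swap_apply_right] at h1
    unfold jtDet
    apply Matrix.det_zero_of_row_eq (i := i.castSucc) (j := i.succ) (Fin.castSucc_lt_succ).ne
    funext c
    simp only [Matrix.of_apply, h1]
  · intro β hβ
    obtain ⟨hb, hj⟩ := hidx β (Finset.mem_filter.mp hβ).2
    set i := idx β (Finset.mem_filter.mp hβ).2
    rw [Finset.mem_filter, Finset.mem_finsuppAntidiag] at hβ ⊢
    refine ⟨⟨?_, Finset.subset_univ _⟩, fun hc => ?_⟩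
    · have h1 : ∑ j, (a j + ((g i β j : ℕ) : ℤ)) = ∑ j, (a j + ((β j : ℕ) : ℤ)) := by
        simp only [hg i β hb]
        exact Equiv.sum_comp (Equiv.swap i.castSucc i.succ) (fun j => a j + ((β j : ℕ) : ℤ))
      rw [Finset.sum_add_distrib, Finset.sum_add_distrib] at h1
      have h2 := add_left_cancel h1
      have h3 := hβ.1.1
      rw [← h3]
      exact_mod_cast h2
    · have := hc i
      have := hg_bad i β hb
      omega
  · intro β hβ
    obtain ⟨hb, hj⟩ := hidx β (Finset.mem_filter.mp hβ).2
    set i := idx β (Finset.mem_filter.mp hβ).2 with hi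
    have hb' := hg_bad i β hb
    have hj' := hg_good i β hb hj
    have hnb : ¬ ∀ j : Fin n, a j.succ + (g i β j.succ : ℕ) < a j.castSucc := by
      intro hc
      have := hc i
      omega
    obtain ⟨hb2, hj2⟩ := hidx (g i β) hnb
    have hii : idx (g i β) hnb = i := by
      rcases lt_trichotomy (idx (g i β) hnb) i with hlt | heq | hgt
      · have := hj2 _ hlt; omega
      · exact heq
      · have := hj' _ hgt; omega
    change g (idx (g i β) hnb) (g i β) = β
    rw [hii]
    ext j
    have e1 := hg i (g i β) hb' j
    rw [hg i β hb, Equiv.swap_apply_self] at e1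
    omega

/-- The determinant attached to a sequence, with `n` rows. -/
noncomputable def jtSeq (h : ℤ → R) (n : ℕ) (f : ℕ → ℕ) : R :=
  jtDet h (fun i : Fin n => (f i : ℤ) - (i : ℕ))

/-- Add a box configuration to a sequence. -/
def addSeq (f : ℕ → ℕ) {n : ℕ} (β : Fin (n + 1) →₀ ℕ) : ℕ → ℕ := fun i =>
  f i + if hi : i < n + 1 then β ⟨i, hi⟩ else 0

/-- The configurations giving horizontal strips. -/
noncomputable def strips (f : ℕ → ℕ) (n k : ℕ) : Finset (Fin (n + 1) →₀ ℕ) :=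
  (Finset.finsuppAntidiag (Finset.univ : Finset (Fin (n + 1))) k).filter
    (fun β => ∀ i : Fin n, f (i + 1) + β i.succ ≤ f i)

lemma pieri (h : ℤ → R) (hneg : ∀ d < 0, h d = 0) (n k : ℕ) (f : ℕ → ℕ) (hf : Antitone f)
    (hn : f n = 0) :
    h k * jtSeq h n f = ∑ β ∈ strips f n k, jtSeq h (n + 1) (addSeq f β) := by
  classical
  let a : Fin (n + 1) → ℤ := fun i => (f i : ℤ) - (i : ℕ)
  have h1 := jtDet_mul h hneg a (by simp [a, hn]) k
  have h2 := jtDet_cancel h a (by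
    intro i
    have := hf (Nat.le_succ (i : ℕ))
    simp only [a, Fin.val_succ, Fin.val_castSucc]
    push_cast
    simp only [Nat.succ_eq_add_one] at this
    omega) k
  rw [← Finset.sum_filter_add_sum_filter_not _
    (fun β : Fin (n + 1) →₀ ℕ => ∀ i : Fin n, a i.succ + (β i.succ : ℕ) < a i.castSucc), h2, add_zero] at h1
  have h3 : jtSeq h n f = jtDet h (fun i : Fin n => a i.castSucc) := rfl
  rw [h3, h1]
  apply Finset.sum_congr
  · unfold strips
    apply Finset.filter_congr
    intro β _
    refine forall_congr' fun i => ?_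
    simp only [a, Fin.val_succ, Fin.val_castSucc]
    push_cast
    omega
  · intro β _
    unfold jtSeq
    congr 1
    funext i
    simp only [a, addSeq, i.isLt, dif_pos]
    push_cast
    ring

lemma addSeq_antitone (f : ℕ → ℕ) (hf : Antitone f) (n k : ℕ) (hn : f n = 0)
    (β : Fin (n + 1) →₀ ℕ) (hβ : β ∈ strips f n k) :
    Antitone (addSeq f β) ∧ addSeq f β (n + 1) = 0 := by
  have hz : ∀ i, n ≤ i → f i = 0 := fun i hi => Nat.le_zero.mp (hn ▸ hf hi)
  refine ⟨antitone_nat_of_succ_le fun i => ?_, ?_⟩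
  · unfold addSeq
    by_cases hi : i < n
    · have := (Finset.mem_filter.mp hβ).2 ⟨i, hi⟩
      simp only [Fin.succ_mk] at this
      rw [dif_pos (by omega)]
      omega
    · rw [dif_neg (by omega), hz (i + 1) (by omega)]
      omega
  · simp [addSeq, hz (n + 1) (by omega)]

lemma addSeq_eq (lam f : ℕ → ℕ) (n : ℕ) (hn : f n = 0)
    (β : Fin (n + 1) →₀ ℕ) (hβ : β ∈ strips f n (lam n))
    (heq : ∀ i < n + 1, addSeq f β i = lam i) :
    (∀ i < n, f i = lam i) ∧ β = Finsupp.single (Fin.last n) (lam n) := by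
  classical
  have hsum := (Finset.mem_finsuppAntidiag.mp (Finset.mem_filter.mp hβ).1).1
  have hlast : β (Fin.last n) = lam n := by
    have := heq n (by omega)
    have hl : (⟨n, Nat.lt_succ_self n⟩ : Fin (n + 1)) = Fin.last n := rfl
    simpa [addSeq, hn, hl] using this
  rw [Fin.sum_univ_castSucc, hlast] at hsum
  have h0 : ∑ i : Fin n, β i.castSucc = 0 := by omega
  have h0' : ∀ i : Fin n, β i.castSucc = 0 := by
    intro i
    exact Finset.sum_eq_zero_iff.mp h0 i (Finset.mem_univ _)
  refine ⟨fun i hi => ?_, ?_⟩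
  · have h1 := heq i (by omega)
    have h2 := h0' ⟨i, hi⟩
    simp only [Fin.castSucc_mk] at h2
    simpa [addSeq, h2] using h1
  · ext j
    refine Fin.lastCases ?_ (fun i => ?_) j
    · simp [hlast]
    · rw [h0' i, Finsupp.single_eq_of_ne (Fin.castSucc_ne_last i)]

lemma jtSeq_congr (h : ℤ → R) (n : ℕ) (f g : ℕ → ℕ) (hfg : ∀ i < n, f i = g i) :
    jtSeq h n f = jtSeq h n g := by
  unfold jtSeq
  congr 1
  funext i
  rw [hfg i i.isLt]

lemma expand (h : ℤ → R) (hneg : ∀ d < 0, h d = 0) (lam : ℕ → ℕ)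
    (hlam : Antitone lam) (n : ℕ) :
    ∃ M : Multiset (ℕ → ℕ), (∀ f ∈ M, Antitone f ∧ f n = 0 ∧ ∃ i < n, f i ≠ lam i) ∧
      ∏ i ∈ Finset.range n, h (lam i) = jtSeq h n lam + (M.map (jtSeq h n)).sum := by
  classical
  induction n with
  | zero =>
    refine ⟨0, by simp, ?_⟩
    simp [jtSeq, jtDet]
  | succ n ih =>
    obtain ⟨M, hM, hprod⟩ := ih
    let t : ℕ → ℕ := fun i => if i < n then lam i else 0
    have ht : Antitone t := by
      intro i j hij
      simp only [t]
      split_ifs with h1 h2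
      · exact hlam hij
      · omega
      · exact Nat.zero_le _
      · exact le_rfl
    have htn : t n = 0 := by simp [t]
    let β₀ : Fin (n + 1) →₀ ℕ := Finsupp.single (Fin.last n) (lam n)
    have hβ₀ : β₀ ∈ strips t n (lam n) := by
      refine Finset.mem_filter.mpr ⟨Finset.mem_finsuppAntidiag.mpr ⟨?_, Finset.subset_univ _⟩, ?_⟩
      · rw [Finset.sum_eq_single (Fin.last n)]
        · simp [β₀]
        · intro b _ hb
          simp [β₀, Finsupp.single_eq_of_ne hb]
        · simp
      · intro i
        by_cases hi : i.succ = Fin.last n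
        · have hi' : (i : ℕ) + 1 = n := by simpa [Fin.ext_iff] using hi
          rw [hi]
          simp only [t, β₀, Finsupp.single_eq_same, hi', lt_irrefl, if_false, i.isLt, if_true, zero_add]
          exact hlam i.isLt.le
        · rw [Finsupp.single_eq_of_ne hi, add_zero]
          exact ht (Nat.le_succ _)
    have hadd : ∀ i < n + 1, addSeq t β₀ i = lam i := by
      intro i hi
      by_cases hin : i < n
      · have : (⟨i, hi⟩ : Fin (n + 1)) ≠ Fin.last n := by simp [Fin.ext_iff]; omega
        simp [addSeq, hi, t, hin, β₀, Finsupp.single_eq_of_ne this]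
      · have : i = n := by omega
        subst this
        have : (⟨i, hi⟩ : Fin (i + 1)) = Fin.last i := rfl
        simp [addSeq, t, β₀, this]
    refine ⟨((strips t n (lam n)).erase β₀).val.map (addSeq t) +
      M.bind (fun f => (strips f n (lam n)).val.map (addSeq f)), ?_, ?_⟩
    · intro f hf
      rw [Multiset.mem_add] at hf
      rcases hf with hf | hf
      · obtain ⟨β, hβ, rfl⟩ := Multiset.mem_map.mp hf
        rw [Finset.mem_val, Finset.mem_erase] at hβ
        obtain ⟨h1, h2⟩ := addSeq_antitone t ht n _ htn β hβ.2
        refine ⟨h1, h2, ?_⟩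
        by_contra hc
        push Not at hc
        exact hβ.1 (addSeq_eq lam t n htn β hβ.2 hc).2
      · obtain ⟨μ, hμ, hf⟩ := Multiset.mem_bind.mp hf
        obtain ⟨β, hβ, rfl⟩ := Multiset.mem_map.mp hf
        rw [Finset.mem_val] at hβ
        obtain ⟨hμa, hμ0, i, hi, hne⟩ := hM μ hμ
        obtain ⟨h1, h2⟩ := addSeq_antitone μ hμa n _ hμ0 β hβ
        refine ⟨h1, h2, ?_⟩
        by_contra hc
        push Not at hc
        exact hne ((addSeq_eq lam μ n hμ0 β hβ hc).1 i hi)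
    · rw [Finset.prod_range_succ, hprod, mul_comm, mul_add,
        jtSeq_congr h n lam t (fun i hi => by simp [t, hi]), pieri h hneg n _ t ht htn,
        ← Finset.add_sum_erase _ _ hβ₀, jtSeq_congr h (n + 1) _ lam hadd, add_assoc]
      congr 1
      rw [Multiset.map_add, Multiset.sum_add, Multiset.map_map]
      congr 1
      rw [Multiset.map_bind, Multiset.sum_bind, ← Multiset.sum_map_mul_left]
      congr 1
      apply Multiset.map_congr rfl
      intro f hf
      rw [pieri h hneg n _ f (hM f hf).1 (hM f hf).2.1, Multiset.map_map]
      rfl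

end JTAux

lemma parts_length (ν : Partition') : ν.parts ν.length = 0 :=
  Nat.sInf_mem (s := {n | ν.parts n = 0}) ν.eventually_zero

lemma hpoly_neg (m : ℕ) (d : ℤ) (hd : d < 0) : hpoly m d = 0 := by
  simp [hpoly, not_le.mpr hd]

lemma hpoly_zero (m : ℕ) : hpoly m 0 = 1 := by
  simp [hpoly]

lemma schur_eq (m : ℕ) (ν : Partition') (n : ℕ) (hn : ν.length ≤ n) :
    jtSeq (hpoly m) n ν.parts = schur m ν := by
  induction n, hn using Nat.le_induction with
  | base => rfl
  | succ n hn ih =>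
    rw [← ih]
    have : ν.parts n = 0 := Nat.le_zero.mp (parts_length ν ▸ ν.antitone hn)
    exact jtDet_snoc _ (hpoly_neg m) (hpoly_zero m) _ (by simp [this])

/-- Let `λ` be a partition with `l(λ) = s` and `m ≥ s`. Then there is a finitely
supported family of natural numbers `c_ν`, indexed by partitions `ν ≠ λ` with
`l(ν) ≤ m`, such that in `ℤ[X_1,…,X_m]` one has
`h_{λ_1} ⋯ h_{λ_s} = S_λ^{(m)} + Σ_{ν ≠ λ} c_ν S_ν^{(m)}`; in particular
`S_λ^{(m)}` occurs in `h_{λ_1} ⋯ h_{λ_s}` with coefficient exactly one. -/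
theorem schur_mem_prod_hsymm (lam : Partition') (s m : ℕ)
    (hs : lam.length = s) (hm : s ≤ m) :
    ∃ c : Partition' → ℕ, (Function.support c).Finite ∧
      (∀ ν : Partition', c ν ≠ 0 → ν ≠ lam ∧ ν.length ≤ m) ∧
      ∏ i ∈ Finset.range s, hpoly m (lam.parts i : ℤ) =
        schur m lam + ∑ᶠ ν : Partition', (c ν : ℤ) • schur m ν := by

  classical
  obtain ⟨M, hM, hprod⟩ := expand (hpoly m) (hpoly_neg m) lam.parts lam.antitone s
  let M' : Multiset Partition' :=
    M.pmap (fun f hf => (⟨f, hf.1, s, hf.2.1⟩ : Partition')) hM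
  have hM' : ∀ ν ∈ M', ν ≠ lam ∧ ν.length ≤ s := by
    intro ν hν
    obtain ⟨f, hf, rfl⟩ := Multiset.mem_pmap.mp hν
    obtain ⟨h1, h2, i, hi, hne⟩ := hM f hf
    refine ⟨?_, Nat.sInf_le h2⟩
    intro heq
    exact hne (congrFun (congrArg Partition'.parts heq) i)
  have hmap : M'.map Partition'.parts = M := by
    simp only [M', Multiset.map_pmap]
    rw [Multiset.pmap_eq_map _ (fun f => f), Multiset.map_id']
  refine ⟨fun ν => M'.count ν, ?_, ?_, ?_⟩
  · refine (M'.toFinset.finite_toSet).subset fun ν hν => ?_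
    simpa [Multiset.count_eq_zero] using hν
  · intro ν hν
    obtain ⟨h1, h2⟩ := hM' ν (Multiset.count_ne_zero.mp hν)
    exact ⟨h1, h2.trans hm⟩
  · rw [hprod, schur_eq m lam s hs.le]
    congr 1
    rw [← hmap, Multiset.map_map, finsum_eq_sum_of_support_subset (s := M'.toFinset),
      Multiset.map_congr rfl (g := schur m), Finset.sum_multiset_map_count]
    · exact Finset.sum_congr rfl fun ν _ => by simp
    · intro ν hν
      exact schur_eq m ν s (hM' ν hν).2
    · intro ν hν
      have : M'.count ν ≠ 0 := by
        intro h0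
        simp [h0] at hν
      simpa using Multiset.count_ne_zero.mp this
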